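/- Let f, g, h be twice continuously differentiable. Let x* be feasible for the cardinality constrained problem (CCP), M-stationary, satisfy CC-CPLD, and assume d_xᵀ(∇²f(x*) + Σᵢ λᵢ∇²gᵢ(x*) + Σᵢ μᵢ∇²hᵢ(x*))d_x > 0 for all d_x ∈ C_X(x*) with d_x ≠ 0 and for all M-stationary multipliers (λ, μ, γ) of x*. Then there exists a radius r > 0 such that for every M-stationary point (x, y) ∈ Z with ‖x − x*‖ < r one has x = x*. -/

import Mathlib

open Set Filter Topology

noncomputable section

/-- Number of nonzero components of a vector (the "zero norm"). -/
def card0 {n : ℕ} (x : Fin n → ℝ) : ℕ := {i | x i ≠ 0}.ncard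

/-- First directional derivative `∇φ(x)ᵀd`. -/
def D1 {n : ℕ} (φ : (Fin n → ℝ) → ℝ) (x d : Fin n → ℝ) : ℝ := fderiv ℝ φ x d

/-- Second derivative quadratic form `dᵀ∇²φ(x)d`. -/
def D2 {n : ℕ} (φ : (Fin n → ℝ) → ℝ) (x d : Fin n → ℝ) : ℝ :=
  iteratedFDeriv ℝ 2 φ x ![d, d]

/-- Feasibility for the cardinality constrained problem (CCP):
`g(x) ≤ 0`, `h(x) = 0`, `‖x‖₀ ≤ κ`. -/
def CCPFeasible {n m p : ℕ} (g : (Fin n → ℝ) → Fin m → ℝ) (h : (Fin n → ℝ) → Fin p → ℝ)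
    (κ : ℕ) (x : Fin n → ℝ) : Prop :=
  (∀ i, g x i ≤ 0) ∧ (∀ i, h x i = 0) ∧ card0 x ≤ κ

/-- Feasible set `Z` of the continuous reformulation. -/
def ZSet {n m p : ℕ} (g : (Fin n → ℝ) → Fin m → ℝ) (h : (Fin n → ℝ) → Fin p → ℝ)
    (κ : ℕ) : Set ((Fin n → ℝ) × (Fin n → ℝ)) :=
  {z | (∀ i, g z.1 i ≤ 0) ∧ (∀ i, h z.1 i = 0) ∧ (∀ i, 0 ≤ z.2 i) ∧ (∀ i, z.2 i ≤ 1) ∧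
    ((n : ℝ) - (κ : ℝ) ≤ ∑ i, z.2 i) ∧ ∀ i, z.1 i * z.2 i = 0}

/-- `(lam, mu, gam)` is an M-stationary multiplier at `x`. -/
def IsMMult {n m p : ℕ} (f : (Fin n → ℝ) → ℝ) (g : (Fin n → ℝ) → Fin m → ℝ)
    (h : (Fin n → ℝ) → Fin p → ℝ) (x : Fin n → ℝ)
    (lam : Fin m → ℝ) (mu : Fin p → ℝ) (gam : Fin n → ℝ) : Prop :=
  (∀ d, D1 f x d + ∑ i, lam i * D1 (fun x' => g x' i) x d
      + ∑ i, mu i * D1 (fun x' => h x' i) x d + ∑ i, gam i * d i = 0) ∧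
  (∀ i, 0 ≤ lam i) ∧ (∀ i, lam i * g x i = 0) ∧ (∀ i, x i ≠ 0 → gam i = 0)

/-- `(lam, mu, gam)` is an S-stationary multiplier at `(x, y)`. -/
def IsSMult {n m p : ℕ} (f : (Fin n → ℝ) → ℝ) (g : (Fin n → ℝ) → Fin m → ℝ)
    (h : (Fin n → ℝ) → Fin p → ℝ) (x y : Fin n → ℝ)
    (lam : Fin m → ℝ) (mu : Fin p → ℝ) (gam : Fin n → ℝ) : Prop :=
  IsMMult f g h x lam mu gam ∧ ∀ i, x i = 0 → y i = 0 → gam i = 0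

/-- `z` is an M-stationary point of the continuous reformulation. -/
def MStationary {n m p : ℕ} (f : (Fin n → ℝ) → ℝ) (g : (Fin n → ℝ) → Fin m → ℝ)
    (h : (Fin n → ℝ) → Fin p → ℝ) (κ : ℕ) (z : (Fin n → ℝ) × (Fin n → ℝ)) : Prop :=
  z ∈ ZSet g h κ ∧ ∃ lam mu gam, IsMMult f g h z.1 lam mu gam

/-- `z` is an S-stationary point of the continuous reformulation. -/
def SStationary {n m p : ℕ} (f : (Fin n → ℝ) → ℝ) (g : (Fin n → ℝ) → Fin m → ℝ)
    (h : (Fin n → ℝ) → Fin p → ℝ) (κ : ℕ) (z : (Fin n → ℝ) × (Fin n → ℝ)) : Prop :=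
  z ∈ ZSet g h κ ∧ ∃ lam mu gam, IsSMult f g h z.1 z.2 lam mu gam

/-- CC-LICQ at `x`: the active gradients `∇gᵢ(x)` (`gᵢ(x) = 0`), all `∇hᵢ(x)`,
and the unit vectors `eᵢ` (`xᵢ = 0`) are linearly independent. -/
def CCLICQ {n m p : ℕ} (g : (Fin n → ℝ) → Fin m → ℝ) (h : (Fin n → ℝ) → Fin p → ℝ)
    (x : Fin n → ℝ) : Prop :=
  ∀ (lam : Fin m → ℝ) (mu : Fin p → ℝ) (gam : Fin n → ℝ),
    (∀ i, g x i ≠ 0 → lam i = 0) → (∀ i, x i ≠ 0 → gam i = 0) →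
    (∀ d, ∑ i, lam i * D1 (fun x' => g x' i) x d
        + ∑ i, mu i * D1 (fun x' => h x' i) x d + ∑ i, gam i * d i = 0) →
    lam = 0 ∧ mu = 0 ∧ gam = 0

/-- CC-MFCQ at `x`: the active gradients `∇gᵢ(x)` together with all `∇hᵢ(x)` and the
unit vectors `eᵢ` (`xᵢ = 0`) are positively linearly independent. -/
def CCMFCQ {n m p : ℕ} (g : (Fin n → ℝ) → Fin m → ℝ) (h : (Fin n → ℝ) → Fin p → ℝ)
    (x : Fin n → ℝ) : Prop :=
  ∀ (lam : Fin m → ℝ) (mu : Fin p → ℝ) (gam : Fin n → ℝ),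
    (∀ i, 0 ≤ lam i) → (∀ i, g x i ≠ 0 → lam i = 0) → (∀ i, x i ≠ 0 → gam i = 0) →
    (∀ d, ∑ i, lam i * D1 (fun x' => g x' i) x d
        + ∑ i, mu i * D1 (fun x' => h x' i) x d + ∑ i, gam i * d i = 0) →
    lam = 0 ∧ mu = 0 ∧ gam = 0

/-- The linear combination `Σ lamᵢ ∇gᵢ(x) + Σ muᵢ ∇hᵢ(x) + Σ gamᵢ eᵢ` vanishes. -/
def CombZero {n m p : ℕ} (g : (Fin n → ℝ) → Fin m → ℝ) (h : (Fin n → ℝ) → Fin p → ℝ)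
    (lam : Fin m → ℝ) (mu : Fin p → ℝ) (gam : Fin n → ℝ) (x : Fin n → ℝ) : Prop :=
  ∀ d, ∑ i, lam i * D1 (fun x' => g x' i) x d
      + ∑ i, mu i * D1 (fun x' => h x' i) x d + ∑ i, gam i * d i = 0

/-- CC-CPLD at `x`: whenever gradients indexed by subsets of the active sets are
positively linearly dependent at `x`, they remain linearly dependent nearby. -/
def CCCPLD {n m p : ℕ} (g : (Fin n → ℝ) → Fin m → ℝ) (h : (Fin n → ℝ) → Fin p → ℝ)
    (x : Fin n → ℝ) : Prop :=
  ∀ (I1 : Finset (Fin m)) (I2 : Finset (Fin p)) (I3 : Finset (Fin n)),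
    (∀ i ∈ I1, g x i = 0) → (∀ i ∈ I3, x i = 0) →
    (∃ lam mu gam, (∀ i, 0 ≤ lam i) ∧ (∀ i, i ∉ I1 → lam i = 0) ∧ (∀ i, i ∉ I2 → mu i = 0) ∧
      (∀ i, i ∉ I3 → gam i = 0) ∧ ¬(lam = 0 ∧ mu = 0 ∧ gam = 0) ∧ CombZero g h lam mu gam x) →
    ∀ᶠ x' in nhds x, ∃ lam mu gam, (∀ i, i ∉ I1 → lam i = 0) ∧ (∀ i, i ∉ I2 → mu i = 0) ∧
      (∀ i, i ∉ I3 → gam i = 0) ∧ ¬(lam = 0 ∧ mu = 0 ∧ gam = 0) ∧ CombZero g h lam mu gam x'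

/-- The CC-linearisation cone `L_Z(x, y)` (as a predicate on `(dx, dy)`). -/
def LinCone {n m p : ℕ} (g : (Fin n → ℝ) → Fin m → ℝ) (h : (Fin n → ℝ) → Fin p → ℝ)
    (κ : ℕ) (x y dx dy : Fin n → ℝ) : Prop :=
  (∀ i, g x i = 0 → D1 (fun x' => g x' i) x dx ≤ 0) ∧
  (∀ i, D1 (fun x' => h x' i) x dx = 0) ∧
  ((∑ i, y i = (n : ℝ) - (κ : ℝ)) → 0 ≤ ∑ i, dy i) ∧
  (∀ i, x i ≠ 0 → y i = 0 → dy i = 0) ∧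
  (∀ i, x i = 0 → y i = 0 → 0 ≤ dy i) ∧
  (∀ i, x i = 0 → y i = 1 → dy i ≤ 0) ∧
  (∀ i, x i = 0 → 0 < y i → dx i = 0) ∧
  (∀ i, x i = 0 → y i = 0 → dx i * dy i = 0)

/-- The CC-critical cone `C_Z(x, y)`. -/
def CritCone {n m p : ℕ} (f : (Fin n → ℝ) → ℝ) (g : (Fin n → ℝ) → Fin m → ℝ)
    (h : (Fin n → ℝ) → Fin p → ℝ) (κ : ℕ) (x y dx dy : Fin n → ℝ) : Prop :=
  LinCone g h κ x y dx dy ∧ D1 f x dx ≤ 0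

/-- The critical cone `C_X(x)` for the original cardinality constrained problem. -/
def CritConeX {n m p : ℕ} (f : (Fin n → ℝ) → ℝ) (g : (Fin n → ℝ) → Fin m → ℝ)
    (h : (Fin n → ℝ) → Fin p → ℝ) (κ : ℕ) (x dx : Fin n → ℝ) : Prop :=
  (∀ i, g x i = 0 → D1 (fun x' => g x' i) x dx ≤ 0) ∧
  (∀ i, D1 (fun x' => h x' i) x dx = 0) ∧
  (n - κ ≤ {i | x i = 0 ∧ dx i = 0}.ncard) ∧
  D1 f x dx ≤ 0

/-- `x` is a local minimum of the cardinality constrained problem. -/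
def LocalMinCCP {n m p : ℕ} (f : (Fin n → ℝ) → ℝ) (g : (Fin n → ℝ) → Fin m → ℝ)
    (h : (Fin n → ℝ) → Fin p → ℝ) (κ : ℕ) (x : Fin n → ℝ) : Prop :=
  CCPFeasible g h κ x ∧ ∃ r > (0 : ℝ), ∀ x', CCPFeasible g h κ x' → dist x' x < r → f x ≤ f x'

/-- `x` is a strict local minimum of the cardinality constrained problem. -/
def StrictLocalMinCCP {n m p : ℕ} (f : (Fin n → ℝ) → ℝ) (g : (Fin n → ℝ) → Fin m → ℝ)
    (h : (Fin n → ℝ) → Fin p → ℝ) (κ : ℕ) (x : Fin n → ℝ) : Prop :=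
  CCPFeasible g h κ x ∧
    ∃ r > (0 : ℝ), ∀ x', CCPFeasible g h κ x' → dist x' x < r → x' ≠ x → f x < f x'

/-- `z` is a local minimum of the continuous reformulation. -/
def LocalMinZ {n m p : ℕ} (f : (Fin n → ℝ) → ℝ) (g : (Fin n → ℝ) → Fin m → ℝ)
    (h : (Fin n → ℝ) → Fin p → ℝ) (κ : ℕ) (z : (Fin n → ℝ) × (Fin n → ℝ)) : Prop :=
  z ∈ ZSet g h κ ∧ ∃ r > (0 : ℝ), ∀ z' ∈ ZSet g h κ, dist z' z < r → f z.1 ≤ f z'.1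

/-- `z` is a strict local minimum with respect to `x` of the continuous reformulation. -/
def StrictLocalMinX {n m p : ℕ} (f : (Fin n → ℝ) → ℝ) (g : (Fin n → ℝ) → Fin m → ℝ)
    (h : (Fin n → ℝ) → Fin p → ℝ) (κ : ℕ) (z : (Fin n → ℝ) × (Fin n → ℝ)) : Prop :=
  z ∈ ZSet g h κ ∧
    ∃ r > (0 : ℝ), ∀ z' ∈ ZSet g h κ, dist z' z < r → z'.1 ≠ z.1 → f z.1 < f z'.1

/-- Feasible set `Z(t)` of the Scholtes-type regularized program NLP(t). -/
def ZReg {n m p : ℕ} (g : (Fin n → ℝ) → Fin m → ℝ) (h : (Fin n → ℝ) → Fin p → ℝ)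
    (κ : ℕ) (t : ℝ) : Set ((Fin n → ℝ) × (Fin n → ℝ)) :=
  {z | (∀ i, g z.1 i ≤ 0) ∧ (∀ i, h z.1 i = 0) ∧ (∀ i, 0 ≤ z.2 i) ∧ (∀ i, z.2 i ≤ 1) ∧
    ((n : ℝ) - (κ : ℝ) ≤ ∑ i, z.2 i) ∧ (∀ i, z.1 i * z.2 i ≤ t) ∧ ∀ i, -t ≤ z.1 i * z.2 i}

/-- `z` is a local minimum of the regularized program NLP(t). -/
def LocalMinReg {n m p : ℕ} (f : (Fin n → ℝ) → ℝ) (g : (Fin n → ℝ) → Fin m → ℝ)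
    (h : (Fin n → ℝ) → Fin p → ℝ) (κ : ℕ) (t : ℝ) (z : (Fin n → ℝ) × (Fin n → ℝ)) : Prop :=
  z ∈ ZReg g h κ t ∧ ∃ r > (0 : ℝ), ∀ z' ∈ ZReg g h κ t, dist z' z < r → f z.1 ≤ f z'.1

/-- `z` is a KKT point of the regularized program NLP(t). -/
def KKTReg {n m p : ℕ} (f : (Fin n → ℝ) → ℝ) (g : (Fin n → ℝ) → Fin m → ℝ)
    (h : (Fin n → ℝ) → Fin p → ℝ) (κ : ℕ) (t : ℝ) (z : (Fin n → ℝ) × (Fin n → ℝ)) : Prop :=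
  z ∈ ZReg g h κ t ∧
  ∃ (lam : Fin m → ℝ) (mu : Fin p → ℝ) (nu0 nu1 : Fin n → ℝ) (rho : ℝ) (dpl dmi : Fin n → ℝ),
    (∀ d : Fin n → ℝ, D1 f z.1 d + ∑ i, lam i * D1 (fun x' => g x' i) z.1 d
        + ∑ i, mu i * D1 (fun x' => h x' i) z.1 d
        + ∑ i, (dpl i - dmi i) * z.2 i * d i = 0) ∧
    (∀ i, -nu0 i + nu1 i - rho + (dpl i - dmi i) * z.1 i = 0) ∧
    (∀ i, 0 ≤ lam i) ∧ (∀ i, 0 ≤ nu0 i) ∧ (∀ i, 0 ≤ nu1 i) ∧ 0 ≤ rho ∧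
    (∀ i, 0 ≤ dpl i) ∧ (∀ i, 0 ≤ dmi i) ∧
    (∀ i, lam i * g z.1 i = 0) ∧ (∀ i, nu0 i * z.2 i = 0) ∧ (∀ i, nu1 i * (z.2 i - 1) = 0) ∧
    rho * (∑ i, z.2 i - ((n : ℝ) - (κ : ℝ))) = 0 ∧
    (∀ i, dpl i * (z.1 i * z.2 i - t) = 0) ∧ (∀ i, dmi i * (z.1 i * z.2 i + t) = 0)

/-- Standard MFCQ for the regularized program NLP(t) at a feasible point `z`. -/
def MFCQReg {n m p : ℕ} (g : (Fin n → ℝ) → Fin m → ℝ) (h : (Fin n → ℝ) → Fin p → ℝ)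
    (κ : ℕ) (t : ℝ) (z : (Fin n → ℝ) × (Fin n → ℝ)) : Prop :=
  (∀ mu : Fin p → ℝ, (∀ d, ∑ i, mu i * D1 (fun x' => h x' i) z.1 d = 0) → mu = 0) ∧
  ∃ dx dy : Fin n → ℝ,
    (∀ i, D1 (fun x' => h x' i) z.1 dx = 0) ∧
    (∀ i, g z.1 i = 0 → D1 (fun x' => g x' i) z.1 dx < 0) ∧
    (∀ i, z.2 i = 0 → 0 < dy i) ∧
    (∀ i, z.2 i = 1 → dy i < 0) ∧
    (∑ i, z.2 i = (n : ℝ) - (κ : ℝ) → 0 < ∑ i, dy i) ∧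
    (∀ i, z.1 i * z.2 i = t → z.2 i * dx i + z.1 i * dy i < 0) ∧
    (∀ i, z.1 i * z.2 i = -t → 0 < z.2 i * dx i + z.1 i * dy i)

/-- Carathéodory reduction of the support of a linear combination: the coefficients can be replaced
by coefficients of the same sign whose support indexes a linearly independent family. -/
lemma exists_linearIndependent_support {ι V : Type*} [Fintype ι] [AddCommGroup V] [Module ℝ V]
    (v : ι → V) (a : ι → ℝ) :
    ∃ b : ι → ℝ, ∑ i, b i • v i = ∑ i, a i • v i ∧ (∀ i, b i ≠ 0 → a i ≠ 0) ∧
      (∀ i, 0 ≤ a i → 0 ≤ b i) ∧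
      ∀ e : ι → ℝ, (∀ i, b i = 0 → e i = 0) → ∑ i, e i • v i = 0 → e = 0 := by
  classical
  let P : (ι → ℝ) → Prop := fun b => ∑ i, b i • v i = ∑ i, a i • v i ∧
    (∀ i, b i ≠ 0 → a i ≠ 0) ∧ ∀ i, 0 ≤ a i → 0 ≤ b i
  obtain ⟨b, ⟨hb1, hb2, hb3⟩, hmin⟩ : ∃ b, P b ∧ ∀ b', P b' →
      ¬ ({i | b' i ≠ 0} : Finset ι).card < ({i | b i ≠ 0} : Finset ι).card := by
    have hwf := (measure fun b : ι → ℝ => ({i | b i ≠ 0} : Finset ι).card).wf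
    obtain ⟨b, hb, hb'⟩ := hwf.has_min {b | P b} ⟨a, rfl, fun _ h => h, fun _ h => h⟩
    exact ⟨b, hb, fun b' h' => hb' b' h'⟩
  refine ⟨b, hb1, hb2, hb3, fun e he hsum => ?_⟩
  by_contra hne
  have hne' : ({i | e i ≠ 0} : Finset ι).Nonempty := by
    obtain ⟨i, hi⟩ := Function.ne_iff.1 hne
    exact ⟨i, by simpa using hi⟩
  obtain ⟨j, hj, hjmin⟩ := Finset.exists_min_image _ (fun i => |b i / e i|) hne'
  have hej : e j ≠ 0 := by simpa using hj
  have hle : ∀ i, |b j / e j * e i| ≤ |b i| := by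
    intro i
    by_cases hi : e i = 0
    · simp [hi]
    · have h1 := hjmin i (by simpa using hi)
      calc |b j / e j * e i| = |b j / e j| * |e i| := abs_mul _ _
        _ ≤ |b i / e i| * |e i| := by gcongr
        _ = |b i| := by rw [← abs_mul, div_mul_cancel₀ _ hi]
  refine hmin (fun i => b i - b j / e j * e i) ⟨?_, ?_, ?_⟩ (Finset.card_lt_card ?_)
  · simp only [sub_smul, Finset.sum_sub_distrib, mul_smul, ← Finset.smul_sum, hsum, hb1,
      smul_zero, sub_zero]
  · intro i hi
    refine hb2 i fun h0 => hi ?_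
    simp [h0, he i h0]
  · intro i hi
    have h1 := le_abs_self (b j / e j * e i)
    have h2 := hle i
    rw [abs_of_nonneg (hb3 i hi)] at h2
    linarith
  · refine Finset.ssubset_iff_subset_ne.2 ⟨fun i hi => ?_, fun heq => ?_⟩
    · simp only [Finset.mem_filter, Finset.mem_univ, true_and] at hi ⊢
      exact fun h0 => hi (by simp [h0, he i h0])
    · have hbj : b j ≠ 0 := fun h0 => hej (he j h0)
      have : j ∈ ({i | b i - b j / e j * e i ≠ 0} : Finset ι) := by
        rw [heq]; simpa using hbj
      simp [div_mul_cancel₀ _ hej] at this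

section Taylor

variable {E : Type*} [NormedAddCommGroup E] [NormedSpace ℝ E]

/-- First-order expansion of the derivative of a `C²` function. -/
lemma isLittleO_fderiv_sub {φ : E → ℝ} (hφ : ContDiff ℝ 2 φ) (a : E) :
    (fun x => fderiv ℝ φ x - fderiv ℝ φ a - fderiv ℝ (fderiv ℝ φ) a (x - a))
      =o[𝓝 a] fun x => x - a := by
  have h1 : ContDiff ℝ 1 (fderiv ℝ φ) := hφ.fderiv_right (by norm_num)
  exact ((h1.differentiable (by norm_num)) a).hasFDerivAt.isLittleO

/-- Second-order Taylor expansion of a `C²` function with Peano remainder. -/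
lemma isLittleO_taylor_two {φ : E → ℝ} (hφ : ContDiff ℝ 2 φ) (a : E) :
    (fun x => φ x - φ a - fderiv ℝ φ a (x - a)
      - 1 / 2 * fderiv ℝ (fderiv ℝ φ) a (x - a) (x - a)) =o[𝓝 a] fun x => ‖x - a‖ ^ 2 := by
  set B := fderiv ℝ (fderiv ℝ φ) a with hB
  have hsymm : ∀ u w, B u w = B w u := by
    have := (hφ.contDiffAt (x := a)).isSymmSndFDerivAt (by simp)
    exact fun u w => this u w
  have hder : ∀ x, HasFDerivAt (fun x => φ x - φ a - fderiv ℝ φ a (x - a)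
      - 1 / 2 * B (x - a) (x - a)) (fderiv ℝ φ x - fderiv ℝ φ a - B (x - a)) x := by
    intro x
    have h0 := (hφ.differentiable (by norm_num) x).hasFDerivAt
    have h1 : HasFDerivAt (fun x : E => x - a) (ContinuousLinearMap.id ℝ E) x :=
      (hasFDerivAt_id x).sub_const a
    have h2 : HasFDerivAt (fun x => fderiv ℝ φ a (x - a)) (fderiv ℝ φ a) x := by
      exact (fderiv ℝ φ a).hasFDerivAt.comp x h1
    have h3 : HasFDerivAt (fun x => B (x - a)) B x := by
      exact B.hasFDerivAt.comp x h1
    have h4 := (h3.clm_apply h1).const_mul (1 / 2)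
    refine (((h0.sub_const (φ a)).sub h2).sub h4).congr_fderiv ?_
    ext w
    simp only [FunLike.coe_sub, Pi.sub_apply, FunLike.coe_smul, Pi.smul_apply, FunLike.coe_add,
      Pi.add_apply, ContinuousLinearMap.comp_id, ContinuousLinearMap.flip_apply, smul_eq_mul,
      hsymm w (x - a)]
    ring
  refine Asymptotics.isLittleO_iff.2 fun c hc => ?_
  obtain ⟨r, hr, hball⟩ := Metric.eventually_nhds_iff_ball.1
    (Asymptotics.isLittleO_iff.1 (isLittleO_fderiv_sub hφ a) hc)
  filter_upwards [Metric.ball_mem_nhds a hr] with x hx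
  have hsub : Metric.closedBall a ‖x - a‖ ⊆ Metric.ball a r := by
    intro y hy
    rw [Metric.mem_closedBall] at hy
    rw [Metric.mem_ball, dist_eq_norm] at hx
    exact hy.trans_lt hx
  have := (convex_closedBall a ‖x - a‖).norm_image_sub_le_of_norm_hasFDerivWithin_le
    (f := fun x => φ x - φ a - fderiv ℝ φ a (x - a) - 1 / 2 * B (x - a) (x - a))
    (C := c * ‖x - a‖) (fun y _ => (hder y).hasFDerivWithinAt)
    (fun y hy => (hball y (hsub hy)).trans (by
      rw [Metric.mem_closedBall, dist_eq_norm] at hy; gcongr))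
    (x := a) (y := x) (by simp) (by simp [dist_eq_norm])
  simpa [pow_two, mul_assoc] using this

variable {φ : E → ℝ} {a d : E} {F : Filter E}

/-- Directional first-order limit along a tangential filter. -/
lemma tendsto_div_norm_sub (hφ : DifferentiableAt ℝ φ a) (hF : F ≤ 𝓝[≠] a)
    (hd : Tendsto (fun x => ‖x - a‖⁻¹ • (x - a)) F (𝓝 d)) :
    Tendsto (fun x => ‖x - a‖⁻¹ * (φ x - φ a)) F (𝓝 (fderiv ℝ φ a d)) := by
  have h1 := ((hφ.hasFDerivAt.isLittleO.mono (hF.trans nhdsWithin_le_nhds)).norm_right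
    ).tendsto_div_nhds_zero
  have h2 := ((fderiv ℝ φ a).continuous.tendsto d).comp hd
  refine (zero_add (fderiv ℝ φ a d) ▸ h1.add h2).congr fun x => ?_
  simp only [Function.comp, map_smul, smul_eq_mul]
  ring

/-- Scaled second-order Taylor remainder at the base point. -/
lemma tendsto_taylor_two_left (hφ : ContDiff ℝ 2 φ) (hF : F ≤ 𝓝[≠] a)
    (hd : Tendsto (fun x => ‖x - a‖⁻¹ • (x - a)) F (𝓝 d)) :
    Tendsto (fun x => (φ x - φ a - fderiv ℝ φ a (x - a)) / ‖x - a‖ ^ 2) F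
      (𝓝 (1 / 2 * fderiv ℝ (fderiv ℝ φ) a d d)) := by
  have h1 := ((isLittleO_taylor_two hφ a).mono
    (hF.trans nhdsWithin_le_nhds)).tendsto_div_nhds_zero
  have h2 := (((fderiv ℝ (fderiv ℝ φ) a).continuous₂.tendsto (d, d)).comp
    (hd.prodMk_nhds hd)).const_mul (1 / 2 : ℝ)
  refine (zero_add (1 / 2 * fderiv ℝ (fderiv ℝ φ) a d d) ▸ h1.add h2).congr fun x => ?_
  simp only [Function.comp, Function.uncurry, map_smul, smul_eq_mul, FunLike.coe_smul,
    Pi.smul_apply]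
  field_simp
  ring

/-- Scaled second-order Taylor remainder at the moving point. -/
lemma tendsto_taylor_two_right (hφ : ContDiff ℝ 2 φ) (hF : F ≤ 𝓝[≠] a)
    (hd : Tendsto (fun x => ‖x - a‖⁻¹ • (x - a)) F (𝓝 d)) :
    Tendsto (fun x => (φ x - φ a - fderiv ℝ φ x (x - a)) / ‖x - a‖ ^ 2) F
      (𝓝 (-(1 / 2 * fderiv ℝ (fderiv ℝ φ) a d d))) := by
  have h0 : Tendsto (fun x => ‖x - a‖⁻¹ • (fderiv ℝ φ x - fderiv ℝ φ a)) F
      (𝓝 (fderiv ℝ (fderiv ℝ φ) a d)) := by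
    have h1 := (((isLittleO_fderiv_sub hφ a).mono
      (hF.trans nhdsWithin_le_nhds)).norm_right).tendsto_inv_smul_nhds_zero
    have h2 := ((fderiv ℝ (fderiv ℝ φ) a).continuous.tendsto d).comp hd
    refine (zero_add (fderiv ℝ (fderiv ℝ φ) a d) ▸ h1.add h2).congr fun x => ?_
    simp only [Function.comp, map_smul, ← smul_add, sub_add_cancel]
  have h3 := (tendsto_taylor_two_left hφ hF hd).sub
    ((isBoundedBilinearMap_apply.continuous.tendsto (_, d)).comp (h0.prodMk_nhds hd))
  rw [show ∀ t : ℝ, -(1 / 2 * t) = 1 / 2 * t - t by intro t; ring]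
  refine h3.congr fun x => ?_
  simp only [Function.comp, map_smul, smul_eq_mul, FunLike.coe_smul, Pi.smul_apply,
    FunLike.coe_sub, Pi.sub_apply]
  field_simp
  ring

end Taylor

section Multipliers

variable {ι E : Type*} [Fintype ι] [NormedAddCommGroup E] [NormedSpace ℝ E]

/-- Multipliers `c` at `x` for the objective `f` and the constraint functions `G i`, with sign
condition on the indices in `S` and complementary slackness. -/
structure IsMultiplier (f : E → ℝ) (G : ι → E → ℝ) (S : Set ι) (x : E) (c : ι → ℝ) : Prop where
  stationary : fderiv ℝ f x + ∑ i, c i • fderiv ℝ (G i) x = 0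
  nonneg : ∀ i ∈ S, 0 ≤ c i
  complementary : ∀ i, c i ≠ 0 → G i x = 0

/-- Positive linear dependence at `a` of constraint gradients active at `a` persists nearby as
linear dependence. -/
def CPLDAt (G : ι → E → ℝ) (S : Set ι) (a : E) : Prop :=
  ∀ I : Set ι, (∀ i ∈ I, G i a = 0) →
    (∃ c : ι → ℝ, (∀ i ∈ S, 0 ≤ c i) ∧ (∀ i ∉ I, c i = 0) ∧ c ≠ 0 ∧
      ∑ i, c i • fderiv ℝ (G i) a = 0) →
    ∀ᶠ x in 𝓝 a, ∃ c : ι → ℝ, (∀ i ∉ I, c i = 0) ∧ c ≠ 0 ∧ ∑ i, c i • fderiv ℝ (G i) x = 0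

variable {f : E → ℝ} {G : ι → E → ℝ} {S : Set ι} {a : E}

lemma IsMultiplier.exists_linearIndependent {x : E} {c : ι → ℝ} (hc : IsMultiplier f G S x c) :
    ∃ b, IsMultiplier f G S x b ∧ ∀ e : ι → ℝ, (∀ i, b i = 0 → e i = 0) →
      ∑ i, e i • fderiv ℝ (G i) x = 0 → e = 0 := by
  obtain ⟨b, h1, h2, h3, h4⟩ := exists_linearIndependent_support (fun i => fderiv ℝ (G i) x) c
  exact ⟨b, ⟨h1 ▸ hc.stationary, fun i hi => h3 i (hc.nonneg i hi),
    fun i hi => hc.complementary i (h2 i hi)⟩, h4⟩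

/-- Under CPLD, multipliers with linearly independent support converge along ultrafilters. -/
lemma exists_tendsto_multiplier (hf : ContDiff ℝ 1 f) (hG : ∀ i, ContDiff ℝ 1 (G i))
    (hcpld : CPLDAt G S a) {F : Ultrafilter E} (hF : (F : Filter E) ≤ 𝓝 a) {c : E → ι → ℝ}
    (hc : ∀ᶠ x in (F : Filter E), IsMultiplier f G S x (c x))
    (hact : ∀ i, (∀ᶠ x in (F : Filter E), c x i ≠ 0) → G i a = 0)
    (hli : ∀ᶠ x in (F : Filter E), ∀ e : ι → ℝ, (∀ i, c x i = 0 → e i = 0) →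
      ∑ i, e i • fderiv ℝ (G i) x = 0 → e = 0) :
    ∃ c₀, Tendsto c F (𝓝 c₀) := by
  let s : E → ℝ := fun x => (1 + ‖c x‖)⁻¹
  have hpos : ∀ x, 0 < 1 + ‖c x‖ := fun x => by positivity
  have hs : ∀ x, s x + ‖s x • c x‖ = 1 := fun x => by
    have := hpos x
    rw [norm_smul, Real.norm_of_nonneg (inv_nonneg.2 this.le)]
    simp only [s]
    field_simp
  have hs0 : ∀ x, 0 ≤ s x := fun x => inv_nonneg.2 (hpos x).le
  obtain ⟨⟨s₀, b⟩, -, hlim⟩ := (isCompact_closedBall (0 : ℝ × (ι → ℝ)) 1).ultrafilter_le_nhds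
    (F.map fun x => (s x, s x • c x)) (by
      rw [le_principal_iff]
      refine Filter.Eventually.of_forall (f := (F : Filter E)) fun x => ?_
      refine mem_closedBall_zero_iff.2 ?_
      rw [Prod.norm_def]
      have h1 := hs x
      have h2 := norm_nonneg (s x • c x)
      have h3 := hs0 x
      refine max_le ?_ ?_
      · rw [Real.norm_of_nonneg h3]; linarith
      · simp only; linarith)
  have hlim' : Tendsto (fun x => (s x, s x • c x)) F (𝓝 (s₀, b)) := hlim
  have hls : Tendsto s F (𝓝 s₀) := (continuous_fst.tendsto _).comp hlim'
  have hlb : Tendsto (fun x => s x • c x) F (𝓝 b) := (continuous_snd.tendsto _).comp hlim'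
  by_cases h0 : s₀ = 0
  · exfalso
    subst h0
    have hb1 : 0 + ‖b‖ = 1 :=
      tendsto_nhds_unique (hls.add hlb.norm) (by simp only [hs]; exact tendsto_const_nhds)
    have hfa : Tendsto (fderiv ℝ f) F (𝓝 (fderiv ℝ f a)) :=
      ((hf.continuous_fderiv (by norm_num)).tendsto a).mono_left hF
    have hGa : ∀ i, Tendsto (fderiv ℝ (G i)) F (𝓝 (fderiv ℝ (G i) a)) := fun i =>
      (((hG i).continuous_fderiv (by norm_num)).tendsto a).mono_left hF
    have hbi : ∀ i, Tendsto (fun x => s x * c x i) F (𝓝 (b i)) := fun i =>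
      ((continuous_apply i).tendsto _).comp hlb
    have hzero : ∑ i, b i • fderiv ℝ (G i) a = 0 := by
      have h1 := (hls.smul hfa).add (tendsto_finsetSum Finset.univ
        fun i _ => (hbi i).smul (hGa i))
      have h2 : (0 : ℝ) • fderiv ℝ f a + ∑ i, b i • fderiv ℝ (G i) a = 0 := by
        refine tendsto_nhds_unique h1 (Tendsto.congr' ?_ tendsto_const_nhds)
        filter_upwards [hc] with x hx
        simp only [mul_smul, ← Finset.smul_sum, ← smul_add, hx.stationary, smul_zero]
      simpa using h2
    have hdep := Filter.Eventually.filter_mono hF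
      (hcpld {i | ∀ᶠ x in (F : Filter E), c x i ≠ 0} hact
      ⟨b, fun i hi => ge_of_tendsto (hbi i) (hc.mono fun x hx =>
        mul_nonneg (hs0 x) (hx.nonneg i hi)), fun i hi => ?_, ?_, hzero⟩)
    · have hall : ∀ᶠ x in (F : Filter E), ∀ i, (∀ᶠ x in (F : Filter E), c x i ≠ 0) →
          c x i ≠ 0 := by
        refine eventually_all.2 fun i => ?_
        by_cases hi : ∀ᶠ x in (F : Filter E), c x i ≠ 0
        · exact hi.mono fun _ h _ => h
        · exact Filter.Eventually.of_forall fun _ h => absurd h hi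
      obtain ⟨x, ⟨e, he1, he2, he3⟩, hx1, hx2⟩ := (hdep.and (hall.and hli)).exists
      exact he2 (hx2 e (fun i hi => he1 i fun hmem => hx1 i hmem hi) he3)
    · have hi' : ∀ᶠ x in (F : Filter E), c x i = 0 := by
        simpa using Ultrafilter.eventually_not.2 hi
      refine tendsto_nhds_unique (hbi i) (Tendsto.congr' ?_ tendsto_const_nhds)
      exact hi'.mono fun x hx => by simp [hx]
    · rintro rfl
      simp at hb1
  · refine ⟨s₀⁻¹ • b, ((hls.inv₀ h0).smul hlb).congr fun x => ?_⟩
    rw [smul_smul, inv_mul_cancel₀ (inv_pos.2 (hpos x)).ne', one_smul]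

/-- Under CPLD, multipliers at points accumulating at `a` in direction `d` yield a multiplier at
`a` for which `d` is a critical direction of zero curvature of the Lagrangian. -/
lemma exists_multiplier_zero_curvature (hf : ContDiff ℝ 2 f) (hG : ∀ i, ContDiff ℝ 2 (G i))
    (hcpld : CPLDAt G S a) {F : Ultrafilter E} (hF : (F : Filter E) ≤ 𝓝[≠] a)
    (hmult : ∀ᶠ x in (F : Filter E), ∃ c, IsMultiplier f G S x c) {d : E}
    (hd : Tendsto (fun x => ‖x - a‖⁻¹ • (x - a)) F (𝓝 d)) :
    ∃ c, IsMultiplier f G S a c ∧ fderiv ℝ f a d = 0 ∧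
      fderiv ℝ (fderiv ℝ f) a d d + ∑ i, c i * fderiv ℝ (fderiv ℝ (G i)) a d d = 0 := by
  have hFa : (F : Filter E) ≤ 𝓝 a := hF.trans nhdsWithin_le_nhds
  obtain ⟨c, hc'⟩ := (hmult.mono fun x ⟨_, hx⟩ => hx.exists_linearIndependent).choice
  have hc := hc'.mono fun x hx => hx.1
  have hGa : ∀ i, Tendsto (G i) F (𝓝 (G i a)) := fun i =>
    ((hG i).continuous.tendsto a).mono_left hFa
  have hact : ∀ i, (∀ᶠ x in (F : Filter E), c x i ≠ 0) → G i a = 0 := fun i hi =>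
    tendsto_nhds_unique (hGa i) (Tendsto.congr' ((hc.and hi).mono fun x hx =>
      (hx.1.complementary i hx.2).symm) tendsto_const_nhds)
  obtain ⟨c₀, hlim⟩ := exists_tendsto_multiplier (hf.of_le (by norm_num))
    (fun i => (hG i).of_le (by norm_num)) hcpld hFa hc hact (hc'.mono fun x hx => hx.2)
  have hci : ∀ i, Tendsto (fun x => c x i) F (𝓝 (c₀ i)) := fun i =>
    ((continuous_apply i).tendsto _).comp hlim
  have hne : ∀ i, c₀ i ≠ 0 → ∀ᶠ x in (F : Filter E), c x i ≠ 0 := fun i hi =>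
    (hci i).eventually_ne hi
  have hzero : ∀ᶠ x in (F : Filter E), ∀ i, c x i * (G i x - G i a) = 0 := by
    refine eventually_all.2 fun i => ?_
    rcases F.em fun x => c x i = 0 with hi | hi
    · exact hi.mono fun x hx => by simp [hx]
    · filter_upwards [hc, hi] with x hx hxi
      simp [hx.complementary i hxi, hact i hi]
  have hzero₀ : ∀ᶠ x in (F : Filter E), ∀ i, c₀ i * (G i x - G i a) = 0 := by
    refine eventually_all.2 fun i => ?_
    by_cases hi : c₀ i = 0
    · exact Filter.Eventually.of_forall fun x => by simp [hi]
    · filter_upwards [hc, hne i hi] with x hx hxi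
      simp [hx.complementary i hxi, hact i (hne i hi)]
  have hstat : fderiv ℝ f a + ∑ i, c₀ i • fderiv ℝ (G i) a = 0 := by
    refine tendsto_nhds_unique (((hf.continuous_fderiv (by norm_num)).tendsto a).mono_left hFa
      |>.add (tendsto_finsetSum Finset.univ fun i _ => (hci i).smul
        ((((hG i).continuous_fderiv (by norm_num)).tendsto a).mono_left hFa)))
      (Tendsto.congr' (hc.mono fun x hx => hx.stationary.symm) tendsto_const_nhds)
  have hcrit : ∀ i, c₀ i * fderiv ℝ (G i) a d = 0 := fun i => by
    refine tendsto_nhds_unique ((tendsto_div_norm_sub ((hG i).differentiable (by norm_num) a)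
      hF hd).const_mul (c₀ i)) (Tendsto.congr' (hzero₀.mono fun x hx => ?_) tendsto_const_nhds)
    simp only [mul_left_comm (c₀ i), hx i, mul_zero]
  refine ⟨c₀, ⟨hstat, fun i hi => ge_of_tendsto (hci i) (hc.mono fun x hx => hx.nonneg i hi),
    fun i hi => hact i (hne i hi)⟩, ?_, ?_⟩
  · have := DFunLike.congr_fun hstat d
    simpa [hcrit] using this
  · have hleft : Tendsto (fun x => (f x - f a) / ‖x - a‖ ^ 2) F
        (𝓝 (1 / 2 * fderiv ℝ (fderiv ℝ f) a d d +
          ∑ i, c₀ i * (1 / 2 * fderiv ℝ (fderiv ℝ (G i)) a d d))) := by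
      refine ((tendsto_taylor_two_left hf hF hd).add (tendsto_finsetSum Finset.univ fun i _ =>
        (tendsto_taylor_two_left (hG i) hF hd).const_mul (c₀ i))).congr' ?_
      filter_upwards [hzero₀] with x hx
      have h1 := DFunLike.congr_fun hstat (x - a)
      simp only [FunLike.coe_add, Pi.add_apply, FunLike.coe_sum, Finset.sum_apply,
        FunLike.coe_smul, Pi.smul_apply, smul_eq_mul, FunLike.coe_zero, Pi.zero_apply] at h1
      simp only [← mul_div_assoc, mul_sub (c₀ _) (G _ x - G _ a), hx, zero_sub, neg_div,
        Finset.sum_neg_distrib, ← Finset.sum_div]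
      rw [← sub_eq_add_neg, ← sub_div, sub_sub, h1, sub_zero]
    have hright : Tendsto (fun x => (f x - f a) / ‖x - a‖ ^ 2) F
        (𝓝 (-(1 / 2 * fderiv ℝ (fderiv ℝ f) a d d) +
          ∑ i, c₀ i * -(1 / 2 * fderiv ℝ (fderiv ℝ (G i)) a d d))) := by
      refine ((tendsto_taylor_two_right hf hF hd).add (tendsto_finsetSum Finset.univ fun i _ =>
        (hci i).mul (tendsto_taylor_two_right (hG i) hF hd))).congr' ?_
      filter_upwards [hzero, hc] with x hx hxc
      have h1 := DFunLike.congr_fun hxc.stationary (x - a)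
      simp only [FunLike.coe_add, Pi.add_apply, FunLike.coe_sum, Finset.sum_apply,
        FunLike.coe_smul, Pi.smul_apply, smul_eq_mul, FunLike.coe_zero, Pi.zero_apply] at h1
      simp only [← mul_div_assoc, mul_sub (c x _) (G _ x - G _ a), hx, zero_sub, neg_div,
        Finset.sum_neg_distrib, ← Finset.sum_div]
      rw [← sub_eq_add_neg, ← sub_div, sub_sub, h1, sub_zero]
    have := tendsto_nhds_unique hleft hright
    simp only [mul_neg, Finset.sum_neg_distrib, mul_left_comm _ (1 / 2 : ℝ),
      ← Finset.mul_sum] at this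
    linarith

end Multipliers

section Translation

variable {n m p : ℕ} (f : (Fin n → ℝ) → ℝ) (g : (Fin n → ℝ) → Fin m → ℝ)
  (h : (Fin n → ℝ) → Fin p → ℝ)

/-- The constraint functions `gᵢ`, `hᵢ` and the coordinates, as one family. -/
def constraintFun : Fin m ⊕ Fin p ⊕ Fin n → (Fin n → ℝ) → ℝ :=
  Sum.elim (fun i x => g x i) (Sum.elim (fun i x => h x i) fun i x => x i)

variable {f g h}

lemma hasFDerivAt_coord (i : Fin n) (x : Fin n → ℝ) :
    HasFDerivAt (fun x : Fin n → ℝ => x i) (ContinuousLinearMap.proj (R := ℝ) i) x :=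
  (ContinuousLinearMap.proj (R := ℝ) (φ := fun _ : Fin n => ℝ) i).hasFDerivAt

lemma contDiff_constraintFun (hg : ∀ i, ContDiff ℝ 2 (fun x => g x i))
    (hh : ∀ i, ContDiff ℝ 2 (fun x => h x i)) (i : Fin m ⊕ Fin p ⊕ Fin n) :
    ContDiff ℝ 2 (constraintFun g h i) := by
  rcases i with i | i | i
  · exact hg i
  · exact hh i
  · exact contDiff_apply ℝ ℝ i

lemma D2_eq_fderiv (φ : (Fin n → ℝ) → ℝ) (x d : Fin n → ℝ) :
    D2 φ x d = fderiv ℝ (fderiv ℝ φ) x d d := by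
  simp [D2, iteratedFDeriv_two_apply]

lemma sum_fderiv_constraintFun (c : Fin m ⊕ Fin p ⊕ Fin n → ℝ) (x d : Fin n → ℝ) :
    (∑ i, c i • fderiv ℝ (constraintFun g h i) x) d =
      ∑ i, c (.inl i) * D1 (fun x' => g x' i) x d
        + ∑ i, c (.inr (.inl i)) * D1 (fun x' => h x' i) x d + ∑ i, c (.inr (.inr i)) * d i := by
  simp [constraintFun, D1, (hasFDerivAt_coord _ x).fderiv, add_assoc]

lemma sum_fderiv_fderiv_constraintFun (c : Fin m ⊕ Fin p ⊕ Fin n → ℝ) (x d : Fin n → ℝ) :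
    ∑ i, c i * fderiv ℝ (fderiv ℝ (constraintFun g h i)) x d d =
      ∑ i, c (.inl i) * D2 (fun x' => g x' i) x d
        + ∑ i, c (.inr (.inl i)) * D2 (fun x' => h x' i) x d := by
  have hcoord : ∀ i : Fin n, fderiv ℝ (fun x : Fin n → ℝ => x i) =
      fun _ => ContinuousLinearMap.proj (R := ℝ) i :=
    fun i => funext fun y => (hasFDerivAt_coord i y).fderiv
  simp [constraintFun, D2_eq_fderiv, hcoord]

lemma combZero_iff (c : Fin m ⊕ Fin p ⊕ Fin n → ℝ) (x : Fin n → ℝ) :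
    CombZero g h (fun i => c (.inl i)) (fun i => c (.inr (.inl i))) (fun i => c (.inr (.inr i))) x ↔
      ∑ i, c i • fderiv ℝ (constraintFun g h i) x = 0 := by
  simp only [CombZero, DFunLike.ext_iff, sum_fderiv_constraintFun, FunLike.coe_zero, Pi.zero_apply]

lemma isMMult_iff {x : Fin n → ℝ} (hx : ∀ i, h x i = 0) (c : Fin m ⊕ Fin p ⊕ Fin n → ℝ) :
    IsMMult f g h x (fun i => c (.inl i)) (fun i => c (.inr (.inl i))) (fun i => c (.inr (.inr i)))
      ↔ IsMultiplier f (constraintFun g h) (range Sum.inl) x c := by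
  have hstat : (∀ d, D1 f x d + ∑ i, c (.inl i) * D1 (fun x' => g x' i) x d
      + ∑ i, c (.inr (.inl i)) * D1 (fun x' => h x' i) x d + ∑ i, c (.inr (.inr i)) * d i = 0) ↔
      fderiv ℝ f x + ∑ i, c i • fderiv ℝ (constraintFun g h i) x = 0 := by
    simp only [DFunLike.ext_iff, FunLike.coe_add, Pi.add_apply, sum_fderiv_constraintFun,
      FunLike.coe_zero, Pi.zero_apply, ← add_assoc]
    rfl
  constructor
  · rintro ⟨h1, h2, h3, h4⟩
    refine ⟨hstat.1 h1, by rintro _ ⟨i, rfl⟩; exact h2 i, ?_⟩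
    rintro (i | i | i) hi
    · exact (mul_eq_zero.1 (h3 i)).resolve_left hi
    · exact hx i
    · exact not_imp_comm.1 (h4 i) hi
  · rintro ⟨h1, h2, h3⟩
    exact ⟨hstat.2 h1, fun i => h2 _ ⟨i, rfl⟩,
      fun i => mul_eq_zero.2 (or_iff_not_imp_left.2 (h3 (.inl i))),
      fun i => not_imp_comm.1 (h3 (.inr (.inr i)))⟩

lemma CCCPLD.cpldAt {x : Fin n → ℝ} (hx : CCCPLD g h x) :
    CPLDAt (constraintFun g h) (range Sum.inl) x := by
  classical
  rintro I hI ⟨c, hc1, hc2, hc3, hc4⟩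
  refine (hx {i | .inl i ∈ I} {i | .inr (.inl i) ∈ I} {i | .inr (.inr i) ∈ I}
    (fun i hi => hI (.inl i) (by simpa using hi))
    (fun i hi => hI (.inr (.inr i)) (by simpa using hi))
    ⟨_, _, _, fun i => hc1 (.inl i) ⟨i, rfl⟩, fun i hi => hc2 _ (by simpa using hi),
      fun i hi => hc2 _ (by simpa using hi), fun i hi => hc2 _ (by simpa using hi),
      fun ⟨h1, h2, h3⟩ => hc3 ?_, (combZero_iff c x).2 hc4⟩).mono ?_
  · rintro y ⟨lam, mu, gam, h1, h2, h3, hne, hcomb⟩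
    refine ⟨Sum.elim lam (Sum.elim mu gam), ?_, fun h0 => hne ⟨?_, ?_, ?_⟩,
      (combZero_iff (Sum.elim lam (Sum.elim mu gam)) y).1 hcomb⟩
    · rintro (i | i | i) hi
      · exact h1 i (by simpa using hi)
      · exact h2 i (by simpa using hi)
      · exact h3 i (by simpa using hi)
    · exact funext fun i => congrFun h0 (.inl i)
    · exact funext fun i => congrFun h0 (.inr (.inl i))
    · exact funext fun i => congrFun h0 (.inr (.inr i))
  · funext i
    rcases i with i | i | i
    exacts [congrFun h1 i, congrFun h2 i, congrFun h3 i]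

/-- The `x`-part of a point of the reformulation has at least `n - κ` zeros. -/
lemma le_ncard_zeros_of_mem_ZSet {κ : ℕ} {z : (Fin n → ℝ) × (Fin n → ℝ)} (hz : z ∈ ZSet g h κ) :
    n - κ ≤ {i | z.1 i = 0}.ncard := by
  classical
  obtain ⟨-, -, -, hle, hsum, hcompl⟩ := hz
  have h1 : ∑ i, z.2 i ≤ ∑ i, if z.1 i = 0 then (1 : ℝ) else 0 := by
    refine Finset.sum_le_sum fun i _ => ?_
    split_ifs with hi
    · exact hle i
    · exact ((mul_eq_zero.1 (hcompl i)).resolve_left hi).le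
  rw [Finset.sum_boole] at h1
  have h2 : (n : ℝ) ≤ κ + ({i | z.1 i = 0} : Finset (Fin n)).card := by linarith
  have h3 : n ≤ κ + ({i | z.1 i = 0} : Finset (Fin n)).card := by exact_mod_cast h2
  have h4 : {i | z.1 i = 0}.ncard = ({i | z.1 i = 0} : Finset (Fin n)).card := by
    rw [← Set.ncard_coe_finset]; simp
  omega

/-- Limits of normalized feasible displacements with constraint multipliers annihilating the
derivative of the objective lie in the critical cone. -/
lemma critConeX_of_tendsto {κ : ℕ} {xs d : Fin n → ℝ}
    (hg : ∀ i, DifferentiableAt ℝ (fun x => g x i) xs)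
    (hh : ∀ i, DifferentiableAt ℝ (fun x => h x i) xs) (hxs : ∀ i, h xs i = 0)
    {F : Ultrafilter (Fin n → ℝ)} (hF : (F : Filter (Fin n → ℝ)) ≤ 𝓝[≠] xs)
    (hfeas : ∀ᶠ x in (F : Filter (Fin n → ℝ)), ∃ y, (x, y) ∈ ZSet g h κ)
    (hd : Tendsto (fun x => ‖x - xs‖⁻¹ • (x - xs)) F (𝓝 d)) (hfd : D1 f xs d ≤ 0) :
    CritConeX f g h κ xs d := by
  refine ⟨fun i hi => ?_, fun i => ?_, ?_, hfd⟩
  · refine le_of_tendsto (tendsto_div_norm_sub (hg i) hF hd) (hfeas.mono fun x ⟨y, hy⟩ => ?_)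
    rw [hi, sub_zero]
    exact mul_nonpos_of_nonneg_of_nonpos (inv_nonneg.2 (norm_nonneg _)) (hy.1 i)
  · refine tendsto_nhds_unique (tendsto_div_norm_sub (hh i) hF hd)
      (Tendsto.congr' (hfeas.mono fun x ⟨y, hy⟩ => ?_) tendsto_const_nhds)
    have hxi : h x i = 0 := hy.2.1 i
    simp [hxs i, hxi]
  · have hzero : ∀ᶠ x in (F : Filter (Fin n → ℝ)), ∀ i, x i = 0 → xs i = 0 ∧ d i = 0 := by
      refine eventually_all.2 fun i => ?_
      rcases F.em fun x => x i = 0 with hi | hi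
      · have hxi : xs i = 0 := tendsto_nhds_unique
          (((continuous_apply i).tendsto xs).mono_left (hF.trans nhdsWithin_le_nhds))
          (Tendsto.congr' (hi.mono fun x hx => hx.symm) tendsto_const_nhds)
        have hdi : d i = 0 := tendsto_nhds_unique (((continuous_apply i).tendsto d).comp hd)
          (Tendsto.congr' (hi.mono fun x hx => by simp [hx, hxi]) tendsto_const_nhds)
        exact Filter.Eventually.of_forall fun _ _ => ⟨hxi, hdi⟩
      · exact hi.mono fun x hx h0 => absurd h0 hx
    obtain ⟨x, ⟨y, hy⟩, hx⟩ := (hfeas.and hzero).exists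
    exact (le_ncard_zeros_of_mem_ZSet hy).trans (Set.ncard_le_ncard hx (Set.toFinite _))

end Translation

theorem stmt10
    {n m p : ℕ} (f : (Fin n → ℝ) → ℝ) (g : (Fin n → ℝ) → Fin m → ℝ)
    (h : (Fin n → ℝ) → Fin p → ℝ) (κ : ℕ)
    (hn : 0 < n) (hm : 0 < m) (hp : 0 < p) (hκ0 : 0 < κ) (hκn : κ < n)
    (hf : ContDiff ℝ 2 f) (hg : ∀ i, ContDiff ℝ 2 (fun x => g x i))
    (hh : ∀ i, ContDiff ℝ 2 (fun x => h x i))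
    (xs : Fin n → ℝ) (hfeas : CCPFeasible g h κ xs)
    (hM : ∃ lam mu gam, IsMMult f g h xs lam mu gam) (hcpld : CCCPLD g h xs)
    (hsoc : ∀ (lam : Fin m → ℝ) (mu : Fin p → ℝ) (gam : Fin n → ℝ),
      IsMMult f g h xs lam mu gam →
      ∀ dx : Fin n → ℝ, CritConeX f g h κ xs dx → dx ≠ 0 →
        0 < D2 f xs dx + ∑ i, lam i * D2 (fun x' => g x' i) xs dx
        + ∑ i, mu i * D2 (fun x' => h x' i) xs dx) :
    ∃ r > (0 : ℝ), ∀ z ∈ ZSet g h κ, dist z.1 xs < r →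
      MStationary f g h κ z → z.1 = xs := by
  by_contra! hcon
  have hfreq : ∃ᶠ x in 𝓝[≠] xs, ∃ y, MStationary f g h κ (x, y) := by
    refine (Metric.nhdsWithin_basis_ball (x := xs) (s := {xs}ᶜ)).frequently_iff.2 fun r hr => ?_
    obtain ⟨z, -, hz, hst, hne⟩ := hcon r hr
    exact ⟨z.1, ⟨hz, hne⟩, z.2, hst⟩
  have hNeBot := frequently_iff_neBot.1 hfreq
  obtain ⟨F, hF'⟩ := Ultrafilter.exists_le
    (𝓝[≠] xs ⊓ 𝓟 {x | ∃ y, MStationary f g h κ (x, y)})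
  have hF : (F : Filter (Fin n → ℝ)) ≤ 𝓝[≠] xs := hF'.trans inf_le_left
  have hst : ∀ᶠ x in (F : Filter (Fin n → ℝ)), ∃ y, MStationary f g h κ (x, y) :=
    le_principal_iff.1 (hF'.trans inf_le_right)
  have hne : ∀ᶠ x in (F : Filter (Fin n → ℝ)), x ≠ xs := hF self_mem_nhdsWithin
  obtain ⟨d, hd1, hd⟩ := (isCompact_sphere (0 : Fin n → ℝ) 1).ultrafilter_le_nhds
    (F.map fun x => ‖x - xs‖⁻¹ • (x - xs)) (by
      rw [le_principal_iff]
      refine hne.mono fun x hx => mem_sphere_zero_iff_norm.2 ?_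
      rw [norm_smul, norm_inv, norm_norm, inv_mul_cancel₀ (norm_ne_zero_iff.2 (sub_ne_zero.2 hx))])
  have hd0 : d ≠ 0 := ne_zero_of_mem_unit_sphere ⟨d, hd1⟩
  obtain ⟨c, hc, hfd, hcurv⟩ := exists_multiplier_zero_curvature hf
    (contDiff_constraintFun hg hh) hcpld.cpldAt hF
    (hst.mono fun x ⟨y, hz, lam, mu, gam, hmult⟩ =>
      ⟨Sum.elim lam (Sum.elim mu gam), (isMMult_iff hz.2.1 _).1 hmult⟩) hd
  have hpos := hsoc _ _ _ ((isMMult_iff hfeas.2.1 c).2 hc) d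
    (critConeX_of_tendsto (fun i => (hg i).differentiable (by norm_num) xs)
      (fun i => (hh i).differentiable (by norm_num) xs) hfeas.2.1 hF
      (hst.mono fun x ⟨y, hy⟩ => ⟨y, hy.1⟩) hd hfd.le) hd0
  rw [sum_fderiv_fderiv_constraintFun, ← D2_eq_fderiv, ← add_assoc] at hcurv
  exact hpos.ne' hcurv
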